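/- arXiv:1502.02455 — 5 statements merged into one kernel-verified Lean document; each statement's English description precedes it below -/
import Mathlib

section
/- Fix an integer N ≥ 1. Let H be a real symmetric (2N)×(2N) matrix which is positive definite with smallest eigenvalue μ > 0, written in N×N blocks as H = [[P, Mᵀ],[M, Q]], and define D* := (1/2)P, A* := (1/(8π²))Q and B* := (1/(2πi))M. Then for every Schwartz function φ : ℝ^N → ℂ, Re ∫_{ℝ^N} [ (A*∇φ)·conj(∇φ) − φ·(B*z)·conj(∇φ) + (D*z·z)|φ|² ] dz ≥ (μ/(8π²)) ∫_{ℝ^N} ( 4π²|z|²|φ(z)|² + |∇φ(z)|² ) dz. -/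
open MeasureTheory Real ComplexConjugate

lemma pointwise_aux (N : ℕ) (μ : ℝ) 
    (P M Q : Matrix (Fin N) (Fin N) ℝ)
    (hpos : ∀ v : Fin N ⊕ Fin N → ℝ,
      μ * ∑ p : Fin N ⊕ Fin N, v p ^ 2 ≤
        ∑ p : Fin N ⊕ Fin N, ∑ q : Fin N ⊕ Fin N,
          Matrix.fromBlocks P M.transpose M Q p q * v q * v p)
    (z : Fin N → ℝ) (f : ℂ) (w : Fin N → ℂ) :
    (μ / (8 * π ^ 2)) * (4 * π ^ 2 * (∑ j, z j ^ 2) * ‖f‖ ^ 2 + ∑ j, ‖w j‖ ^ 2) ≤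
    ((∑ k : Fin N, (∑ l : Fin N, ((1 / (8 * π ^ 2) * Q k l : ℝ) : ℂ) * w l) * conj (w k))
          - f * ∑ k : Fin N,
              (∑ l : Fin N, (1 / (2 * (π : ℂ) * Complex.I)) * (M k l : ℂ) * (z l : ℂ))
                * conj (w k)
          + ((∑ h : Fin N, ∑ l : Fin N, (1 / 2 : ℝ) * P h l * z l * z h : ℝ) : ℂ)
              * ((‖f‖ ^ 2 : ℝ) : ℂ)).re := by
  have hpi : (π : ℝ) ≠ 0 := Real.pi_ne_zero
  have h1 := hpos (Sum.elim (fun l => 2 * π * z l * f.re) (fun k => (w k).im))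
  have h2 := hpos (Sum.elim (fun l => 2 * π * z l * f.im) (fun k => -(w k).re))
  simp only [Fintype.sum_sum_type, Sum.elim_inl, Sum.elim_inr, Matrix.fromBlocks_apply₁₁,
    Matrix.fromBlocks_apply₁₂, Matrix.fromBlocks_apply₂₁, Matrix.fromBlocks_apply₂₂,
    Matrix.transpose_apply, Finset.sum_add_distrib] at h1 h2
  rw [Finset.sum_comm (f := fun x y => M y x * _ * _)] at h1 h2
  have hI : (1 / (2 * (π : ℂ) * Complex.I)) = ((1 / (2 * π) : ℝ) : ℂ) * (-Complex.I) := by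
    have : (π : ℂ) ≠ 0 := by exact_mod_cast hpi
    push_cast
    field_simp
    simp
  have hn : ∀ c : ℂ, ‖c‖ ^ 2 = c.re ^ 2 + c.im ^ 2 := fun c => by
    rw [← Complex.normSq_eq_norm_sq, Complex.normSq_apply]; ring
  have h3 := mul_le_mul_of_nonneg_left (add_le_add h1 h2)
    (by positivity : (0:ℝ) ≤ 1 / (8 * π ^ 2))
  refine (le_of_eq ?_).trans (h3.trans (le_of_eq ?_))
  · simp only [hn, Finset.mul_sum, Finset.sum_mul, mul_add, ← Finset.sum_add_distrib]
    refine Finset.sum_congr rfl fun j _ => ?_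
    ring
  · rw [hI]
    simp only [Complex.add_re, Complex.sub_re, Finset.sum_mul, Finset.mul_sum, Complex.re_sum,
      ← Finset.sum_add_distrib, mul_add, ← Complex.ofReal_mul, Complex.ofReal_sum,
      ← Finset.sum_sub_distrib, hn]
    refine Finset.sum_congr rfl fun k _ => Finset.sum_congr rfl fun l _ => ?_
    simp only [Complex.mul_re, Complex.mul_im, Complex.conj_re, Complex.conj_im,
      Complex.ofReal_re, Complex.ofReal_im, Complex.neg_re, Complex.neg_im, Complex.I_re,
      Complex.I_im]
    field_simp
    ring

lemma memLp_coord {N : ℕ} (φ : SchwartzMap (EuclideanSpace ℝ (Fin N)) ℂ) (l : Fin N) :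
    MemLp (fun z : EuclideanSpace ℝ (Fin N) => (z l : ℂ) * φ z) 2 volume := by
  have hg : Function.HasTemperateGrowth (fun z : EuclideanSpace ℝ (Fin N) => z l) :=
    (EuclideanSpace.proj l : EuclideanSpace ℝ (Fin N) →L[ℝ] ℝ).hasTemperateGrowth
  have h := (SchwartzMap.smulLeftCLM ℂ (fun z : EuclideanSpace ℝ (Fin N) => z l) φ).memLp 2
    (μ := volume)
  refine h.congr_norm ?_ ?_
  · fun_prop
  · refine Filter.Eventually.of_forall fun z => ?_
    rw [SchwartzMap.smulLeftCLM_apply_apply hg]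
    simp

lemma memLp_der {N : ℕ} (φ : SchwartzMap (EuclideanSpace ℝ (Fin N)) ℂ) (l : Fin N) :
    MemLp (fun z : EuclideanSpace ℝ (Fin N) =>
      fderiv ℝ (⇑φ) z (EuclideanSpace.single l 1)) 2 volume := by
  have h := (LineDeriv.lineDerivOp (EuclideanSpace.single l (1:ℝ)) φ).memLp 2 (μ := volume)
  refine h.congr_norm (h.1.congr ?_) ?_ <;>
  exact Filter.Eventually.of_forall fun z => by
    simp [SchwartzMap.lineDerivOp_apply_eq_fderiv]

lemma int_mul_conj {N : ℕ} {a b : EuclideanSpace ℝ (Fin N) → ℂ} (ha : MemLp a 2 volume)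
    (hb : MemLp b 2 volume) : Integrable (fun z => a z * conj (b z)) volume :=
  MemLp.integrable_mul ha hb.star

theorem coercivity_of_homogenized_form
    (N : ℕ) (hN : 1 ≤ N) (μ : ℝ) (hμ : 0 < μ)
    (P M Q : Matrix (Fin N) (Fin N) ℝ)
    (H : Matrix (Fin N ⊕ Fin N) (Fin N ⊕ Fin N) ℝ)
    (hH : H = Matrix.fromBlocks P M.transpose M Q)
    (hsymm : H.IsSymm)
    (hpos : ∀ v : Fin N ⊕ Fin N → ℝ,
      μ * ∑ p : Fin N ⊕ Fin N, v p ^ 2 ≤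
        ∑ p : Fin N ⊕ Fin N, ∑ q : Fin N ⊕ Fin N, H p q * v q * v p)
    (φ : SchwartzMap (EuclideanSpace ℝ (Fin N)) ℂ) :
    (μ / (8 * π ^ 2)) * ∫ z : EuclideanSpace ℝ (Fin N),
        (4 * π ^ 2 * ‖z‖ ^ 2 * ‖φ z‖ ^ 2
          + ∑ j : Fin N, ‖fderiv ℝ (⇑φ) z (EuclideanSpace.single j 1)‖ ^ 2) ≤
    (∫ z : EuclideanSpace ℝ (Fin N),
        ((∑ k : Fin N, (∑ l : Fin N, ((1 / (8 * π ^ 2) * Q k l : ℝ) : ℂ)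
              * fderiv ℝ (⇑φ) z (EuclideanSpace.single l 1))
            * conj (fderiv ℝ (⇑φ) z (EuclideanSpace.single k 1)))
          - φ z * ∑ k : Fin N,
              (∑ l : Fin N, (1 / (2 * (π : ℂ) * Complex.I)) * (M k l : ℂ) * (z l : ℂ))
                * conj (fderiv ℝ (⇑φ) z (EuclideanSpace.single k 1))
          + ((∑ h : Fin N, ∑ l : Fin N, (1 / 2 : ℝ) * P h l * z l * z h : ℝ) : ℂ)
              * ((‖φ z‖ ^ 2 : ℝ) : ℂ))).re := by
  subst hH
  have hnz : ∀ z : EuclideanSpace ℝ (Fin N), ‖z‖ ^ 2 = ∑ j, z j ^ 2 := fun z => by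
    rw [EuclideanSpace.norm_sq_eq]; simp
  have hcc : ∀ c : ℂ, (((‖c‖ ^ 2 : ℝ)) : ℂ) = c * conj c := fun c => by
    rw [Complex.mul_conj, Complex.normSq_eq_norm_sq]
  have hsq : ∀ {a : EuclideanSpace ℝ (Fin N) → ℂ}, MemLp a 2 volume →
      Integrable (fun z => ‖a z‖ ^ 2) volume := fun ha => ha.integrable_norm_pow two_ne_zero
  have hI1 : Integrable (fun z : EuclideanSpace ℝ (Fin N) =>
      4 * π ^ 2 * ‖z‖ ^ 2 * ‖φ z‖ ^ 2
          + ∑ j : Fin N, ‖fderiv ℝ (⇑φ) z (EuclideanSpace.single j 1)‖ ^ 2) volume := by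
    refine Integrable.add ?_ (integrable_finsetSum _ fun j _ => hsq (memLp_der φ j))
    have : Integrable (fun z : EuclideanSpace ℝ (Fin N) =>
        4 * π ^ 2 * ∑ j, ‖(z j : ℂ) * φ z‖ ^ 2) volume :=
      (integrable_finsetSum _ fun j _ => hsq (memLp_coord φ j)).const_mul _
    refine this.congr (Filter.Eventually.of_forall fun z => ?_)
    simp only [hnz, norm_mul, mul_pow, Complex.norm_real, Real.norm_eq_abs, sq_abs,
      ← Finset.sum_mul]
    ring
  have hI2 : Integrable (fun z : EuclideanSpace ℝ (Fin N) =>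
      ((∑ k : Fin N, (∑ l : Fin N, ((1 / (8 * π ^ 2) * Q k l : ℝ) : ℂ)
              * fderiv ℝ (⇑φ) z (EuclideanSpace.single l 1))
            * conj (fderiv ℝ (⇑φ) z (EuclideanSpace.single k 1)))
          - φ z * ∑ k : Fin N,
              (∑ l : Fin N, (1 / (2 * (π : ℂ) * Complex.I)) * (M k l : ℂ) * (z l : ℂ))
                * conj (fderiv ℝ (⇑φ) z (EuclideanSpace.single k 1))
          + ((∑ h : Fin N, ∑ l : Fin N, (1 / 2 : ℝ) * P h l * z l * z h : ℝ) : ℂ)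
              * ((‖φ z‖ ^ 2 : ℝ) : ℂ))) volume := by
    refine Integrable.add (Integrable.sub ?_ ?_) ?_
    · simp only [Finset.sum_mul]
      refine integrable_finsetSum _ fun k _ => integrable_finsetSum _ fun l _ => ?_
      simp only [mul_assoc]
      exact (int_mul_conj (memLp_der φ l) (memLp_der φ k)).const_mul _
    · simp only [Finset.sum_mul, Finset.mul_sum]
      refine integrable_finsetSum _ fun k _ => integrable_finsetSum _ fun l _ => ?_
      refine ((int_mul_conj (memLp_coord φ l) (memLp_der φ k)).const_mul
        ((1 / (2 * (π : ℂ) * Complex.I)) * (M k l : ℂ))).congr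
        (Filter.Eventually.of_forall fun z => ?_)
      ring
    · simp only [hcc, Complex.ofReal_sum, Finset.sum_mul]
      refine integrable_finsetSum _ fun k _ => integrable_finsetSum _ fun l _ => ?_
      refine ((int_mul_conj (memLp_coord φ l) (memLp_coord φ k)).const_mul
        (((1 / 2 : ℝ) * P k l : ℝ) : ℂ)).congr
        (Filter.Eventually.of_forall fun z => ?_)
      simp only [map_mul, Complex.conj_ofReal, Complex.ofReal_mul]
      ring
  rw [← integral_const_mul]
  refine le_trans ?_ (le_of_eq (integral_re hI2))
  refine integral_mono (hI1.const_mul _) hI2.re fun z => ?_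
  have := pointwise_aux N μ P M Q hpos (fun j => z j) (φ z)
    (fun j => fderiv ℝ (⇑φ) z (EuclideanSpace.single j 1))
  rw [← hnz z] at this
  exact this
end

section
/- Fix an integer N ≥ 1. Let B ∈ ℂ^{N×N} satisfy conj(B) = −B entrywise (all entries purely imaginary), let c ∈ ℂ, and let v : ℝ^N → ℂ be a Schwartz function. Then Im ∫_{ℝ^N} [ v(z)·(Bz)·conj(∇v(z)) − c|v(z)|² ] dz = −( (1/(2i))·tr(B) + Im(c) ) ∫_{ℝ^N} |v(z)|² dz, where (1/(2i))·tr(B) is a real number since tr(B) is purely imaginary. -/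
open MeasureTheory Real ComplexConjugate

lemma aux_int {N : ℕ} (v w : SchwartzMap (EuclideanSpace ℝ (Fin N)) ℂ) (l : Fin N) :
    Integrable (fun z : EuclideanSpace ℝ (Fin N) => (z l : ℂ) * (v z * conj (w z))) := by
  have h := ((w.integrable_pow_mul volume 1).const_mul (SchwartzMap.seminorm ℝ 0 0 v))
  refine h.mono' ?_ (Filter.Eventually.of_forall fun z => ?_)
  · have := v.continuous
    have := w.continuous
    exact Continuous.aestronglyMeasurable (by fun_prop)
  · have h1 := SchwartzMap.norm_le_seminorm ℝ v z
    have h2 : ‖z l‖ ≤ ‖z‖ := PiLp.norm_apply_le z l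
    have h3 : ‖(z l : ℂ) * (v z * conj (w z))‖ = ‖v z‖ * (‖z l‖ * ‖w z‖) := by
      simp only [norm_mul, RCLike.norm_conj, Complex.norm_real]; ring
    rw [h3, pow_one]
    gcongr

lemma aux_int_sq {N : ℕ} (v : SchwartzMap (EuclideanSpace ℝ (Fin N)) ℂ) :
    Integrable (fun z : EuclideanSpace ℝ (Fin N) => ‖v z‖ ^ 2) := by
  have h := ((v.integrable_pow_mul volume 0).const_mul (SchwartzMap.seminorm ℝ 0 0 v))
  refine h.mono' ?_ (Filter.Eventually.of_forall fun z => ?_)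
  · have := v.continuous
    exact Continuous.aestronglyMeasurable (by fun_prop)
  · have h1 := SchwartzMap.norm_le_seminorm ℝ v z
    rw [pow_zero, one_mul, norm_pow, norm_norm, sq]
    gcongr

lemma aux_re {N : ℕ} (v : SchwartzMap (EuclideanSpace ℝ (Fin N)) ℂ) (k l : Fin N) :
    (∫ z : EuclideanSpace ℝ (Fin N), (z l : ℂ) *
      (v z * conj (fderiv ℝ (⇑v) z (EuclideanSpace.single k 1)))).re
    = - (1 / 2) * ((if l = k then 1 else 0) * ∫ z : EuclideanSpace ℝ (Fin N), ‖v z‖ ^ 2) := by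
  let e : EuclideanSpace ℝ (Fin N) := EuclideanSpace.single k 1
  let w : SchwartzMap (EuclideanSpace ℝ (Fin N)) ℂ := LineDeriv.lineDerivOp e v
  have hw : ∀ z, fderiv ℝ (⇑v) z e = w z := fun z => rfl
  have hJ := aux_int v w l
  have hV := aux_int v v l
  have hg : ∀ z, HasFDerivAt (fun z => ‖v z‖ ^ 2)
      (2 • (innerSL ℝ (v z)).comp (fderiv ℝ (⇑v) z)) z := fun z =>
    (v.differentiableAt (x := z)).hasFDerivAt.norm_sq
  have hg' : ∀ z, fderiv ℝ (fun z => ‖v z‖ ^ 2) z e = 2 * (v z * conj (w z)).re := by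
    intro z
    rw [(hg z).fderiv]
    simp [hw, Complex.inner]
    ring
  let P : EuclideanSpace ℝ (Fin N) →L[ℝ] ℝ := EuclideanSpace.proj l
  have hP : ∀ z, P z = z l := fun z => rfl
  have hPe : P e = if l = k then 1 else 0 := by
    simp [hP, e]
  have hPd : ∀ z, fderiv ℝ (fun z => P z) z e = if l = k then 1 else 0 := by
    intro z
    rw [← hPe]
    exact congrArg (fun L => L e) (P.hasFDerivAt (x := z)).fderiv
  have key := integral_mul_fderiv_eq_neg_fderiv_mul_of_integrable
    (μ := (volume : Measure (EuclideanSpace ℝ (Fin N))))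
    (f := fun z => P z) (g := fun z => ‖v z‖ ^ 2) (v := e)
    (by simp only [hPd]; exact (aux_int_sq v).const_mul _)
    (by
      simp only [hg', hP]
      refine (hJ.re.const_mul 2).congr (Filter.Eventually.of_forall fun z => ?_)
      simp
      ring)
    (by
      simp only [hP]
      refine hV.re.congr (Filter.Eventually.of_forall fun z => ?_)
      simp only [Complex.mul_conj, RCLike.re_to_complex, Complex.re_ofReal_mul,
        Complex.ofReal_re, Complex.normSq_eq_norm_sq])
    (fun z _ => P.differentiableAt)
    (fun z _ => (hg z).differentiableAt)
  simp only [hPd] at key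
  simp only [hg', hP, integral_const_mul] at key
  have h2 : (∫ z : EuclideanSpace ℝ (Fin N), (z l : ℂ) * (v z * conj (w z))).re
      = ∫ z : EuclideanSpace ℝ (Fin N), z l * (v z * conj (w z)).re := by
    have := integral_re hJ
    simp only [RCLike.re_to_complex, Complex.re_ofReal_mul] at this
    exact this.symm
  have h3 : ∫ z : EuclideanSpace ℝ (Fin N), z l * (2 * (v z * conj (w z)).re)
      = 2 * ∫ z : EuclideanSpace ℝ (Fin N), z l * (v z * conj (w z)).re := by
    rw [← integral_const_mul]
    congr 1
    ext z
    ring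
  change (∫ z : EuclideanSpace ℝ (Fin N), (z l : ℂ) * (v z * conj (w z))).re = _
  rw [h2]
  rw [h3] at key
  linarith

theorem drift_term_imaginary_part_identity
    (N : ℕ) (hN : 1 ≤ N)
    (B : Matrix (Fin N) (Fin N) ℂ)
    (hB : ∀ k l, conj (B k l) = -(B k l))
    (c : ℂ)
    (v : SchwartzMap (EuclideanSpace ℝ (Fin N)) ℂ) :
    (∫ z : EuclideanSpace ℝ (Fin N),
        (v z * ∑ k : Fin N, (∑ l : Fin N, B k l * (z l : ℂ))
            * conj (fderiv ℝ (⇑v) z (EuclideanSpace.single k 1))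
          - c * ((‖v z‖ ^ 2 : ℝ) : ℂ))).im
    = -(((1 / (2 * Complex.I)) * Matrix.trace B).re + c.im)
        * ∫ z : EuclideanSpace ℝ (Fin N), ‖v z‖ ^ 2 := by
  have hJ : ∀ k l, Integrable (fun z : EuclideanSpace ℝ (Fin N) => (z l : ℂ) *
      (v z * conj (fderiv ℝ (⇑v) z (EuclideanSpace.single k 1)))) := fun k l =>
    aux_int v (LineDeriv.lineDerivOp (EuclideanSpace.single k (1 : ℝ)) v) l
  have hre : ∀ k l, (B k l).re = 0 := by
    intro k l
    have := congrArg Complex.re (hB k l)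
    simp at this
    linarith
  have h1 : ∀ z : EuclideanSpace ℝ (Fin N),
      v z * ∑ k : Fin N, (∑ l : Fin N, B k l * (z l : ℂ))
            * conj (fderiv ℝ (⇑v) z (EuclideanSpace.single k 1))
      = ∑ k : Fin N, ∑ l : Fin N, B k l * ((z l : ℂ) *
      (v z * conj (fderiv ℝ (⇑v) z (EuclideanSpace.single k 1)))) := by
    intro z
    simp only [Finset.mul_sum, Finset.sum_mul]
    refine Finset.sum_congr rfl fun k _ => Finset.sum_congr rfl fun l _ => ?_
    ring
  simp only [h1]
  have hS : ∀ k, Integrable (fun z : EuclideanSpace ℝ (Fin N) => ∑ l : Fin N, B k l *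
      ((z l : ℂ) * (v z * conj (fderiv ℝ (⇑v) z (EuclideanSpace.single k 1))))) := fun k =>
    integrable_finsetSum _ fun l _ => (hJ k l).const_mul _
  have hT : Integrable (fun z : EuclideanSpace ℝ (Fin N) => ∑ k : Fin N, ∑ l : Fin N, B k l *
      ((z l : ℂ) * (v z * conj (fderiv ℝ (⇑v) z (EuclideanSpace.single k 1))))) :=
    integrable_finsetSum _ fun k _ => hS k
  have hC : Integrable (fun z : EuclideanSpace ℝ (Fin N) => c * ((‖v z‖ ^ 2 : ℝ) : ℂ)) :=
    (aux_int_sq v).ofReal.const_mul c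
  have hI : ∀ k, ∫ z : EuclideanSpace ℝ (Fin N), ∑ l : Fin N, B k l *
      ((z l : ℂ) * (v z * conj (fderiv ℝ (⇑v) z (EuclideanSpace.single k 1))))
      = ∑ l : Fin N, B k l * ∫ z : EuclideanSpace ℝ (Fin N),
      ((z l : ℂ) * (v z * conj (fderiv ℝ (⇑v) z (EuclideanSpace.single k 1)))) := by
    intro k
    rw [integral_finsetSum _ fun l _ => (hJ k l).const_mul _]
    simp only [integral_const_mul]
  rw [integral_sub hT hC, integral_finsetSum _ fun k _ => hS k]
  simp only [hI]
  simp only [integral_const_mul, integral_complex_ofReal, Complex.sub_im, Complex.im_sum,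
    Complex.mul_im, hre, aux_re, zero_mul, zero_add, Complex.ofReal_im, Complex.ofReal_re,
    mul_zero]
  have ht : ((1 / (2 * Complex.I)) * Matrix.trace B).re = (1 / 2) * ∑ k, (B k k).im := by
    have : (1 / (2 * Complex.I)) = -(1 / 2 : ℝ) * Complex.I := by
      push_cast
      field_simp
      simp
    rw [this]
    simp [Matrix.trace, Complex.mul_re, Complex.im_sum]
  rw [ht]
  simp [Finset.mul_sum, Finset.sum_mul, add_mul, ← sub_eq_add_neg]
  ring_nf
  congr 1
  rw [Finset.mul_sum]
  refine Finset.sum_congr rfl fun k _ => ?_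
  ring
end

section
/- Fix an integer N ≥ 1. Let A*, D* be real symmetric N×N matrices, let B* ∈ ℂ^{N×N} satisfy conj(B*) = −B* entrywise, and let c* ∈ ℂ satisfy (1/(2i))·tr(B*) + Im(c*) = 0. Let v : ℝ × ℝ^N → ℂ be smooth, such that for every compact interval I ⊂ ℝ the Schwartz seminorms of z ↦ v(t,z) and of z ↦ ∂_t v(t,z) are bounded uniformly for t ∈ I, and suppose that i ∂_t v − div(A*∇v) + div(v B*z) + c* v + (D*z·z) v = 0 holds at every (t,z) ∈ ℝ × ℝ^N (all spatial differential operators acting in z). Then ∫_{ℝ^N} |v(t,z)|² dz = ∫_{ℝ^N} |v(0,z)|² dz for every t ∈ ℝ. -/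
open MeasureTheory Real ComplexConjugate

/-- The homogenized Schrödinger operator with linear drift and quadratic potential:
`𝔸*φ = −div(A*∇φ) + div(φ B*z) + c*φ + (D*z·z)φ`, where
`div(φ B*z) = (B*z)·∇φ + tr(B*)φ`. -/
noncomputable def homOp {N : ℕ} (Astar Dstar : Matrix (Fin N) (Fin N) ℝ)
    (Bstar : Matrix (Fin N) (Fin N) ℂ) (cstar : ℂ)
    (φ : EuclideanSpace ℝ (Fin N) → ℂ) (z : EuclideanSpace ℝ (Fin N)) : ℂ :=
  (- ∑ k : Fin N, fderiv ℝ
      (fun w => ∑ l : Fin N, (Astar k l : ℂ) * fderiv ℝ φ w (EuclideanSpace.single l 1))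
      z (EuclideanSpace.single k 1))
  + ((∑ k : Fin N, (∑ l : Fin N, Bstar k l * (z l : ℂ))
        * fderiv ℝ φ z (EuclideanSpace.single k 1))
     + Matrix.trace Bstar * φ z)
  + cstar * φ z
  + ((∑ h : Fin N, ∑ l : Fin N, Dstar h l * z l * z h : ℝ) : ℂ) * φ z

/-- `v(t,·)` and `∂ₜv(t,·)` have Schwartz seminorms bounded uniformly on compact
time intervals. -/
def UnifSchwartz {N : ℕ} (w : ℝ → EuclideanSpace ℝ (Fin N) → ℂ) : Prop :=
  ∀ a b : ℝ, ∀ k n : ℕ, ∃ C : ℝ,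
    ∀ t ∈ Set.Icc a b, ∀ z : EuclideanSpace ℝ (Fin N),
      ‖z‖ ^ k * ‖iteratedFDeriv ℝ n (w t) z‖ ≤ C

open scoped SchwartzMap LineDeriv

lemma aux_integral_lineDeriv_zero {N : ℕ} (G : 𝓢(EuclideanSpace ℝ (Fin N), ℂ))
    (e : EuclideanSpace ℝ (Fin N)) :
    Integrable (fun x => fderiv ℝ G x e) ∧ ∫ x, fderiv ℝ G x e = 0 := by
  have hi : Integrable (fun x => fderiv ℝ G x e) := by
    have := (∂_{e} G).integrable (μ := volume)
    refine this.congr (Filter.Eventually.of_forall fun x => ?_)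
    simp [SchwartzMap.lineDerivOp_apply_eq_fderiv]
  refine ⟨hi, ?_⟩
  have := integral_mul_fderiv_eq_neg_fderiv_mul_of_integrable (μ := volume)
    (f := fun _ : EuclideanSpace ℝ (Fin N) => (1 : ℂ)) (g := G) (v := e)
    (by simp) (by simpa using hi) (by simpa using G.integrable)
    (fun x _ => by fun_prop) (fun x _ => G.differentiableAt)
  simpa using this

/-- flux term coming from the second order part -/
lemma aux_G {N : ℕ} (φ : 𝓢(EuclideanSpace ℝ (Fin N), ℂ)) (k l : EuclideanSpace ℝ (Fin N)) :
    Integrable (fun x => conj (fderiv ℝ φ x k) * fderiv ℝ φ x l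
      + conj (φ x) * fderiv ℝ (fun w => fderiv ℝ φ w l) x k) ∧
    ∫ x, (conj (fderiv ℝ φ x k) * fderiv ℝ φ x l
      + conj (φ x) * fderiv ℝ (fun w => fderiv ℝ φ w l) x k) = 0 := by
  let cφ : 𝓢(EuclideanSpace ℝ (Fin N), ℂ) :=
    φ.postcompCLM (Complex.conjCLE : ℂ →L[ℝ] ℂ)
  let G : 𝓢(EuclideanSpace ℝ (Fin N), ℂ) :=
    SchwartzMap.pairing (ContinuousLinearMap.mul ℝ ℂ) cφ (∂_{l} φ)
  have hG : (G : EuclideanSpace ℝ (Fin N) → ℂ) = fun x => conj (φ x) * (∂_{l} φ) x := rfl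
  have hl : ((∂_{l} φ : 𝓢(EuclideanSpace ℝ (Fin N), ℂ)) : EuclideanSpace ℝ (Fin N) → ℂ)
      = fun w => fderiv ℝ φ w l := by
    funext w; exact SchwartzMap.lineDerivOp_apply_eq_fderiv _ _ _
  have key : (fun x => fderiv ℝ G x k) = fun x => conj (fderiv ℝ φ x k) * fderiv ℝ φ x l
      + conj (φ x) * fderiv ℝ (fun w => fderiv ℝ φ w l) x k := by
    funext x
    have h1 : HasFDerivAt φ (fderiv ℝ φ x) x := φ.differentiableAt.hasFDerivAt
    have h2 : HasFDerivAt (fun x => conj (φ x))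
        ((Complex.conjCLE : ℂ →L[ℝ] ℂ).comp (fderiv ℝ φ x)) x :=
      (Complex.conjCLE : ℂ →L[ℝ] ℂ).hasFDerivAt.comp x h1
    have h3 := (∂_{l} φ).differentiableAt.hasFDerivAt (x := x)
    have h4 := (h2.mul h3).fderiv
    rw [hl] at h4
    rw [hG, hl]
    erw [h4]
    simp
    ring
  have := aux_integral_lineDeriv_zero G k
  rw [key] at this
  exact this

/-- flux term coming from the drift -/
lemma aux_H {N : ℕ} (φ : 𝓢(EuclideanSpace ℝ (Fin N), ℂ)) (k l : Fin N) :
    Integrable (fun x => (if k = l then 1 else 0) * (conj (φ x) * φ x)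
      + (x l : ℂ) * (conj (fderiv ℝ φ x (EuclideanSpace.single k 1)) * φ x
      + conj (φ x) * fderiv ℝ φ x (EuclideanSpace.single k 1))) ∧
    ∫ x, ((if k = l then 1 else 0) * (conj (φ x) * φ x)
      + (x l : ℂ) * (conj (fderiv ℝ φ x (EuclideanSpace.single k 1)) * φ x
      + conj (φ x) * fderiv ℝ φ x (EuclideanSpace.single k 1))) = 0 := by
  let cφ : 𝓢(EuclideanSpace ℝ (Fin N), ℂ) :=
    φ.postcompCLM (Complex.conjCLE : ℂ →L[ℝ] ℂ)
  let P : 𝓢(EuclideanSpace ℝ (Fin N), ℂ) :=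
    SchwartzMap.pairing (ContinuousLinearMap.mul ℝ ℂ) cφ φ
  let L : EuclideanSpace ℝ (Fin N) →L[ℝ] ℂ :=
    Complex.ofRealCLM.comp (EuclideanSpace.proj l : EuclideanSpace ℝ (Fin N) →L[ℝ] ℝ)
  let G : 𝓢(EuclideanSpace ℝ (Fin N), ℂ) :=
    SchwartzMap.bilinLeftCLM (ContinuousLinearMap.mul ℝ ℂ).flip L.hasTemperateGrowth P
  have hG : (G : EuclideanSpace ℝ (Fin N) → ℂ) = fun x => L x * (conj (φ x) * φ x) := rfl
  have key : (fun x => fderiv ℝ G x (EuclideanSpace.single k 1)) =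
    fun x => (if k = l then 1 else 0) * (conj (φ x) * φ x)
      + (x l : ℂ) * (conj (fderiv ℝ φ x (EuclideanSpace.single k 1)) * φ x
      + conj (φ x) * fderiv ℝ φ x (EuclideanSpace.single k 1)) := by
    funext x
    have h1 : HasFDerivAt φ (fderiv ℝ φ x) x := φ.differentiableAt.hasFDerivAt
    have h2 : HasFDerivAt (fun x => conj (φ x))
        ((Complex.conjCLE : ℂ →L[ℝ] ℂ).comp (fderiv ℝ φ x)) x :=
      (Complex.conjCLE : ℂ →L[ℝ] ℂ).hasFDerivAt.comp x h1
    have h4 := ((L.hasFDerivAt (x := x)).mul (h2.mul h1)).fderiv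
    rw [hG]
    erw [h4]
    by_cases hkl : k = l
    · subst hkl
      simp [L]
      ring
    · simp [L, hkl, Ne.symm hkl]
      ring
  have := aux_integral_lineDeriv_zero G (EuclideanSpace.single k 1)
  rw [key] at this
  exact this

/-- pointwise algebra -/
lemma aux_alg {N : ℕ} (A D : Matrix (Fin N) (Fin N) ℝ) (hA : A.IsSymm)
    (B : Matrix (Fin N) (Fin N) ℂ)
    (hB : ∀ k l, (starRingEnd ℂ) (B k l) = -(B k l)) (c : ℂ)
    (hc : (1 / (2 * Complex.I)) * Matrix.trace B + (c.im : ℂ) = 0)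
    (f w : ℂ) (p : Fin N → ℂ) (q : Fin N → Fin N → ℂ) (z : Fin N → ℝ) (d : ℝ)
    (h : Complex.I * w + ((- ∑ k, ∑ l, (A k l : ℂ) * q k l)
      + ((∑ k, (∑ l, B k l * (z l : ℂ)) * p k) + Matrix.trace B * f) + c * f + (d : ℂ) * f) = 0) :
    2 * (conj f * w).re = (∑ k, ∑ l, ((-2 * Complex.I * A k l) * (conj (p k) * p l + conj f * q k l)
      + (Complex.I * B k l) * ((if k = l then 1 else 0) * (conj f * f)
        + (z l : ℂ) * (conj (p k) * f + conj f * p k)))).re := by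
  have hw : w = Complex.I * ((- ∑ k, ∑ l, (A k l : ℂ) * q k l)
      + ((∑ k, (∑ l, B k l * (z l : ℂ)) * p k) + Matrix.trace B * f) + c * f + (d : ℂ) * f) := by
    linear_combination (-Complex.I) * h + w * Complex.I_sq
  have hBre : ∀ k l, (B k l).re = 0 := fun k l => by
    have := congrArg Complex.re (hB k l)
    simp at this; linarith
  have htre : (Matrix.trace B).re = 0 := by
    simp [Matrix.trace, hBre]
  have hcim : c.im = - (Matrix.trace B).im / 2 := by
    have h2 := congrArg (fun u => (2 * Complex.I * u).im) hc
    have h3 : 2 * Complex.I * ((1 / (2 * Complex.I)) * Matrix.trace B + (c.im : ℂ))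
      = Matrix.trace B + 2 * Complex.I * c.im := by
      field_simp
    simp only [h3] at h2
    simp at h2
    linarith
  have hS : (∑ k, ∑ l, (A k l : ℂ) * (conj (p k) * p l)).im = 0 := by
    apply Complex.conj_eq_iff_im.1
    rw [map_sum]
    simp_rw [map_sum]
    rw [Finset.sum_comm]
    refine Finset.sum_congr rfl fun k _ => Finset.sum_congr rfl fun l _ => ?_
    rw [hA.apply]
    simp only [map_mul, Complex.conj_ofReal, Complex.conj_conj]
    ring
  have hsplit : (∑ k, ∑ l, ((-2 * Complex.I * A k l) * (conj (p k) * p l + conj f * q k l)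
      + (Complex.I * B k l) * ((if k = l then 1 else 0) * (conj f * f)
        + (z l : ℂ) * (conj (p k) * f + conj f * p k))))
      = -2 * Complex.I * (∑ k, ∑ l, (A k l : ℂ) * (conj (p k) * p l))
        - 2 * Complex.I * conj f * (∑ k, ∑ l, (A k l : ℂ) * q k l)
        + Complex.I * Matrix.trace B * (conj f * f)
        + ∑ k, ∑ l, Complex.I * B k l * z l * (conj (p k) * f + conj f * p k) := by
    have htr : Complex.I * Matrix.trace B * (conj f * f)
      = ∑ k, ∑ l, (Complex.I * B k l) * ((if k = l then 1 else 0) * (conj f * f)) := by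
      simp [Matrix.trace, Finset.mul_sum, Finset.sum_mul]
    rw [htr]
    simp only [Finset.mul_sum, ← Finset.sum_add_distrib, ← Finset.sum_sub_distrib]
    refine Finset.sum_congr rfl fun k _ => Finset.sum_congr rfl fun l _ => ?_
    ring
  have hBB : (∑ k, ∑ l, Complex.I * B k l * z l * (conj (p k) * f + conj f * p k)).re
      = 2 * (conj f * Complex.I * (∑ k, (∑ l, B k l * (z l : ℂ)) * p k)).re := by
    simp only [Finset.mul_sum, Finset.sum_mul, Complex.re_sum]
    refine Finset.sum_congr rfl fun k _ => Finset.sum_congr rfl fun l _ => ?_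
    simp [hBre]
    ring
  rw [hsplit, hw]
  simp only [Complex.add_re, Complex.sub_re] 
  rw [hBB]
  generalize (∑ k, (∑ l, B k l * (z l : ℂ)) * p k) = X
  generalize (∑ k, ∑ l, (A k l : ℂ) * q k l) = Y
  generalize (∑ k, ∑ l, (A k l : ℂ) * (conj (p k) * p l)) = S at hS
  simp [hS, hcim, htre]
  ring

lemma aux_slice {N : ℕ} (A D : Matrix (Fin N) (Fin N) ℝ) (hA : A.IsSymm)
    (B : Matrix (Fin N) (Fin N) ℂ)
    (hB : ∀ k l, (starRingEnd ℂ) (B k l) = -(B k l)) (c : ℂ)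
    (hc : (1 / (2 * Complex.I)) * Matrix.trace B + (c.im : ℂ) = 0)
    (φ : 𝓢(EuclideanSpace ℝ (Fin N), ℂ)) (w : EuclideanSpace ℝ (Fin N) → ℂ)
    (h : ∀ z, Complex.I * w z + homOp A D B c φ z = 0) :
    ∫ z, 2 * (conj (φ z) * w z).re = 0 := by
  let T : Fin N → Fin N → EuclideanSpace ℝ (Fin N) → ℂ := fun k l x =>
    (-2 * Complex.I * A k l) * (conj (fderiv ℝ φ x (EuclideanSpace.single k 1))
        * fderiv ℝ φ x (EuclideanSpace.single l 1)
      + conj (φ x) * fderiv ℝ (fun w => fderiv ℝ φ w (EuclideanSpace.single l 1)) x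
          (EuclideanSpace.single k 1))
    + (Complex.I * B k l) * ((if k = l then 1 else 0) * (conj (φ x) * φ x)
      + (x l : ℂ) * (conj (fderiv ℝ φ x (EuclideanSpace.single k 1)) * φ x
      + conj (φ x) * fderiv ℝ φ x (EuclideanSpace.single k 1)))
  have hTi : ∀ k l, Integrable (T k l) := fun k l =>
    ((aux_G φ _ _).1.const_mul _).add ((aux_H φ k l).1.const_mul _)
  have hT0 : ∀ k l, ∫ x, T k l x = 0 := fun k l => by
    rw [integral_add ((aux_G φ _ _).1.const_mul _) ((aux_H φ k l).1.const_mul _),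
      integral_const_mul, integral_const_mul, (aux_G φ _ _).2, (aux_H φ k l).2]
    simp
  have hpt : ∀ x, 2 * (conj (φ x) * w x).re = (∑ k, ∑ l, T k l x).re := fun x => by
    refine aux_alg A D hA B hB c hc (φ x) (w x)
      (fun k => fderiv ℝ φ x (EuclideanSpace.single k 1))
      (fun k l => fderiv ℝ (fun w => fderiv ℝ φ w (EuclideanSpace.single l 1)) x
          (EuclideanSpace.single k 1)) (fun l => x l)
      (∑ h : Fin N, ∑ l : Fin N, D h l * x l * x h) ?_
    have hx := h x
    unfold homOp at hx
    rw [← hx]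
    congr 5
    refine Finset.sum_congr rfl fun k _ => ?_
    have hd : ∀ l : Fin N, DifferentiableAt ℝ
        (fun w => fderiv ℝ φ w (EuclideanSpace.single l 1)) x := fun l => by
      have := (∂_{(EuclideanSpace.single l (1:ℝ))} φ).differentiableAt (x := x)
      exact this
    rw [fderiv_fun_sum (fun l _ => (hd l).const_mul _)]
    rw [ContinuousLinearMap.sum_apply]
    refine Finset.sum_congr rfl fun l _ => ?_
    rw [fderiv_const_mul (hd l)]
    simp
  simp_rw [hpt]
  have hI : Integrable (fun x => ∑ k, ∑ l, T k l x) :=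
    integrable_finsetSum _ fun k _ => integrable_finsetSum _ fun l _ => hTi k l
  have := integral_re hI
  simp only [RCLike.re_eq_complex_re] at this
  rw [this, integral_finsetSum _ fun k _ => integrable_finsetSum _ fun l _ => hTi k l]
  simp_rw [integral_finsetSum _ fun l _ => hTi _ l, hT0]
  simp

theorem L2_conservation_homogenized_equation
    (N : ℕ) (hN : 1 ≤ N)
    (Astar Dstar : Matrix (Fin N) (Fin N) ℝ)
    (hA : Astar.IsSymm) (hD : Dstar.IsSymm)
    (Bstar : Matrix (Fin N) (Fin N) ℂ)
    (hB : ∀ k l, (starRingEnd ℂ) (Bstar k l) = -(Bstar k l))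
    (cstar : ℂ)
    (hc : (1 / (2 * Complex.I)) * Matrix.trace Bstar + (cstar.im : ℂ) = 0)
    (v : ℝ → EuclideanSpace ℝ (Fin N) → ℂ)
    (hsmooth : ContDiff ℝ (⊤ : ℕ∞) (Function.uncurry v))
    (hv1 : UnifSchwartz v)
    (hv2 : UnifSchwartz (fun t z => deriv (fun s => v s z) t))
    (heq : ∀ t : ℝ, ∀ z : EuclideanSpace ℝ (Fin N),
      Complex.I * deriv (fun s => v s z) t + homOp Astar Dstar Bstar cstar (v t) z = 0) :
    ∀ t : ℝ, ∫ z : EuclideanSpace ℝ (Fin N), ‖v t z‖ ^ 2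
      = ∫ z : EuclideanSpace ℝ (Fin N), ‖v 0 z‖ ^ 2 := by
  have hvs : ∀ t, ContDiff ℝ (⊤ : ℕ∞) (v t) := fun t =>
    hsmooth.comp (contDiff_const.prodMk contDiff_id)
  have hvt : ∀ z, ContDiff ℝ (⊤ : ℕ∞) (fun s => v s z) := fun z =>
    hsmooth.comp (contDiff_id.prodMk contDiff_const)
  let Φ : ℝ → 𝓢(EuclideanSpace ℝ (Fin N), ℂ) := fun t =>
    { toFun := v t
      smooth' := hvs t
      decay' := fun k n => by
        obtain ⟨C, hC⟩ := hv1 t t k n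
        exact ⟨C, hC t (by simp)⟩ }
  have hslice : ∀ t, ∫ z, 2 * (conj (v t z) * deriv (fun s => v s z) t).re = 0 := fun t =>
    aux_slice Astar Dstar hA Bstar hB cstar hc (Φ t) (fun z => deriv (fun s => v s z) t) (heq t)
  have hdiff : ∀ t z, HasDerivAt (fun s => v s z) (deriv (fun s => v s z) t) t := fun t z =>
    ((hvt z).differentiable (by simp) t).hasDerivAt
  have hdt : ∀ t z, HasDerivAt (fun s => ‖v s z‖ ^ 2)
      (2 * (conj (v t z) * deriv (fun s => v s z) t).re) t := fun t z => by
    have := (hdiff t z).norm_sq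
    convert this using 1
    simp [Complex.inner]
    ring
  have hcontd : ∀ t, Continuous (fun z => deriv (fun s => v s z) t) := fun t => by
    have h1 : (fun z => deriv (fun s => v s z) t) =
        fun z => fderiv ℝ (Function.uncurry v) (t, z) (1, 0) := by
      funext z
      have h2 : HasFDerivAt (Function.uncurry v) (fderiv ℝ (Function.uncurry v) (t, z)) (t, z) :=
        (hsmooth.differentiable (by simp) _).hasFDerivAt
      have h3 : HasDerivAt (fun s : ℝ => (s, z)) ((1 : ℝ), (0 : EuclideanSpace ℝ (Fin N))) t :=
        (hasDerivAt_id t).prodMk (hasDerivAt_const t z)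
      exact (h2.comp_hasDerivAt t h3).deriv
    rw [h1]
    have h4 := hsmooth.continuous_fderiv (by simp)
    exact (h4.comp (by fun_prop : Continuous fun z : EuclideanSpace ℝ (Fin N) => (t, z))).clm_apply
      continuous_const
  have hderiv : ∀ t, HasDerivAt (fun s => ∫ z, ‖v s z‖ ^ 2) 0 t := fun t => by
    obtain ⟨C0, hC0⟩ := hv1 (t - 1) (t + 1) 0 0
    obtain ⟨D0, hD0⟩ := hv2 (t - 1) (t + 1) 0 0
    obtain ⟨D1, hD1⟩ := hv2 (t - 1) (t + 1)
      (0 + (volume : Measure (EuclideanSpace ℝ (Fin N))).integrablePower) 0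
    have hint : Integrable (fun z => ‖v t z‖ ^ 2) := by
      have := (SchwartzMap.pairing (ContinuousLinearMap.mul ℝ ℂ)
        ((Φ t).postcompCLM (Complex.conjCLE : ℂ →L[ℝ] ℂ)) (Φ t)).integrable (μ := volume)
      refine this.norm.congr (Filter.Eventually.of_forall fun z => ?_)
      change ‖conj (v t z) * v t z‖ = _
      rw [norm_mul, RCLike.norm_conj]
      exact (sq _).symm
    have := hasDerivAt_integral_of_dominated_loc_of_deriv_le (μ := volume) (𝕜 := ℝ) (x₀ := t)
      (F := fun s (z : EuclideanSpace ℝ (Fin N)) => ‖v s z‖ ^ 2)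
      (F' := fun s z => 2 * (conj (v s z) * deriv (fun s => v s z) s).re)
      (s := Set.Icc (t - 1) (t + 1))
      (bound := fun z => 2 * (C0 * (2 ^ (volume : Measure (EuclideanSpace ℝ (Fin N))).integrablePower
        * (D0 + D1) * (1 + ‖z‖) ^ (-((volume : Measure (EuclideanSpace ℝ (Fin N))).integrablePower : ℝ)))))
      (Icc_mem_nhds (by linarith) (by linarith))
      (Filter.Eventually.of_forall fun s => ((hvs s).continuous.norm.pow 2).aestronglyMeasurable)
      hint
      (by
        have h1 := (hvs t).continuous
        have h2 := hcontd t
        exact (continuous_const.mul (Complex.continuous_re.comp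
          ((Complex.continuous_conj.comp h1).mul h2))).aestronglyMeasurable)
      (Filter.Eventually.of_forall fun z s hs => by
        have h0 := hC0 s hs z
        have h1 := hD0 s hs z
        have h2 := hD1 s hs z
        simp only [pow_zero, one_mul, norm_iteratedFDeriv_zero] at h0 h1 h2
        have h3 := pow_mul_le_of_le_of_pow_mul_le (norm_nonneg z) (norm_nonneg _) h1 h2
        simp only [pow_zero, one_mul] at h3
        rw [norm_mul, Real.norm_eq_abs, Real.norm_eq_abs, abs_two]
        refine mul_le_mul_of_nonneg_left ?_ two_pos.le
        refine (Complex.abs_re_le_norm _).trans ?_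
        rw [norm_mul, RCLike.norm_conj]
        exact mul_le_mul h0 h3 (norm_nonneg _) ((norm_nonneg _).trans h0))
      (((Measure.integrable_pow_neg_integrablePower _).const_mul _ |>.const_mul _).const_mul _)
      (Filter.Eventually.of_forall fun z s hs => hdt s z)
    have h2 := this.2
    rw [hslice t] at h2
    exact h2
  intro t
  exact is_const_of_deriv_eq_zero (fun s => (hderiv s).differentiableAt)
    (fun s => (hderiv s).deriv) t 0
end

section
/- Assume ψ : ℝ^N → ℂ is smooth, ℤ^N-periodic, with ∫_{[0,1]^N}|ψ|²dy = 1 and 𝔸ψ = 0. Fix k, l ∈ {1,…,N} and assume φ_k, φ_l : ℝ^N → ℂ are smooth ℤ^N-periodic functions satisfying, for m ∈ {k, l}, 𝔸φ_m = 2iπ e_m·(A(∇+2iπθ⁰)ψ) + div(2iπ A e_m ψ) + 2iπθ⁰·(2iπ A e_m ψ). Assume moreover that there exist a smooth ℤ^N-periodic function ξ and a constant Λ ∈ ℂ such that 𝔸ξ = [2iπ e_k·(A(∇+2iπθ⁰)φ_l) + div(2iπ A e_k φ_l) + 2iπθ⁰·(2iπ A e_k φ_l)] + [2iπ e_l·(A(∇+2iπθ⁰)φ_k)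 + div(2iπ A e_l φ_k) + 2iπθ⁰·(2iπ A e_l φ_k)] − 4π²(e_k·(A e_l) + e_l·(A e_k))ψ + Λψ. Then ∫_{[0,1]^N}[2iπ e_k·(A(∇+2iπθ⁰)φ_l)·conj(ψ) − (2iπ A e_k φ_l)·(∇−2iπθ⁰)conj(ψ)]dy + ∫_{[0,1]^N}[2iπ e_l·(A(∇+2iπθ⁰)φ_k)·conj(ψ) − (2iπ A e_l φ_k)·(∇−2iπθ⁰)conj(ψ)]dy − ∫_{[0,1]^N} 4π²(e_k·(A e_l) + e_l·(A e_k))|ψ|² dy + Λ = 0. -/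
open MeasureTheory Real ComplexConjugate

/-- Partial derivative `∂ₖ f` of a function on `ℝ^N`. -/
noncomputable def pd {N : ℕ} (f : (Fin N → ℝ) → ℂ) (k : Fin N) (y : Fin N → ℝ) : ℂ :=
  fderiv ℝ f y (Pi.single k 1)

/-- `ℤ^N`-periodicity. -/
def ZNPeriodic {N : ℕ} {α : Type*} (f : (Fin N → ℝ) → α) : Prop :=
  ∀ q : Fin N → ℤ, ∀ y : Fin N → ℝ, f (fun i => y i + (q i : ℝ)) = f y

/-- `l`-th component of `(∇ + 2iπθ)χ`. -/
noncomputable def gp {N : ℕ} (θ : Fin N → ℝ) (χ : (Fin N → ℝ) → ℂ) (l : Fin N)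
    (y : Fin N → ℝ) : ℂ :=
  pd χ l y + 2 * (π : ℂ) * Complex.I * (θ l : ℂ) * χ y

/-- `j`-th component of `(∇ − 2iπθ)conj(ψ)`. -/
noncomputable def gm {N : ℕ} (θ : Fin N → ℝ) (ψ : (Fin N → ℝ) → ℂ) (j : Fin N)
    (y : Fin N → ℝ) : ℂ :=
  conj (pd ψ j y) - 2 * (π : ℂ) * Complex.I * (θ j : ℂ) * conj (ψ y)

/-- The shifted Bloch cell operator
`𝔸χ = −div(A(∇χ + 2iπθχ)) − 2iπθ·(A(∇χ + 2iπθχ)) + (c − λ)χ`. -/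
noncomputable def blochOp {N : ℕ} (A : (Fin N → ℝ) → Fin N → Fin N → ℝ)
    (c : (Fin N → ℝ) → ℝ) (lam : ℝ) (θ : Fin N → ℝ)
    (χ : (Fin N → ℝ) → ℂ) (y : Fin N → ℝ) : ℂ :=
  - (∑ k : Fin N, fderiv ℝ
      (fun y' => ∑ l : Fin N, (A y' k l : ℂ) * gp θ χ l y') y (Pi.single k 1))
  - (∑ k : Fin N, 2 * (π : ℂ) * Complex.I * (θ k : ℂ)
      * (∑ l : Fin N, (A y k l : ℂ) * gp θ χ l y))
  + ((c y : ℂ) - (lam : ℂ)) * χ y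

/-- The right hand side `2iπ eₘ·(A(∇+2iπθ)χ) + div(2iπ A eₘ χ) + 2iπθ·(2iπ A eₘ χ)`
of the `θ`-differentiated cell equation. -/
noncomputable def dcellθ {N : ℕ} (A : (Fin N → ℝ) → Fin N → Fin N → ℝ)
    (θ : Fin N → ℝ) (χ : (Fin N → ℝ) → ℂ) (m : Fin N) (y : Fin N → ℝ) : ℂ :=
  2 * (π : ℂ) * Complex.I * (∑ l : Fin N, (A y m l : ℂ) * gp θ χ l y)
  + (∑ k : Fin N, fderiv ℝ
      (fun y' => 2 * (π : ℂ) * Complex.I * (A y' k m : ℂ) * χ y') y (Pi.single k 1))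
  + (∑ k : Fin N, 2 * (π : ℂ) * Complex.I * (θ k : ℂ)
      * (2 * (π : ℂ) * Complex.I * (A y k m : ℂ) * χ y))

/-- The unit cell `[0,1]^N`. -/
def unitCell (N : ℕ) : Set (Fin N → ℝ) := Set.univ.pi fun _ => Set.Icc (0 : ℝ) 1

lemma periodic_pd {N : ℕ} {f : (Fin N → ℝ) → ℂ} (h : ZNPeriodic f) (k : Fin N) :
    ZNPeriodic (pd f k) := by
  intro q y
  have h1 : (fun x => f (x + fun i => (q i : ℝ))) = f := by
    funext x
    exact h q x
  unfold pd
  have h2 := fderiv_comp_add_right (𝕜 := ℝ) (f := f) (x := y) (fun i => (q i : ℝ))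
  rw [h1] at h2
  rw [h2]
  rfl

lemma integral_div_zero {N : ℕ} (H : Fin N → (Fin N → ℝ) → ℂ)
    (hs : ∀ k, ContDiff ℝ (⊤ : ℕ∞) (H k)) (hp : ∀ k, ZNPeriodic (H k)) :
    ∫ y in unitCell N, ∑ k, pd (H k) k y = 0 := by
  cases N with
  | zero => simp
  | succ n =>
    have hu : unitCell (n + 1) = Set.Icc (0 : Fin (n+1) → ℝ) 1 := by
      unfold unitCell
      exact Set.pi_univ_Icc _ _
    have hcd : ∀ k, Continuous (pd (H k) k) := fun k =>
      ((hs k).continuous_fderiv (by simp)).clm_apply continuous_const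
    rw [hu]
    have := integral_divergence_of_hasFDerivAt_off_countable' (0 : Fin (n+1) → ℝ) 1
      (by intro i; simp) H (fun k y => fderiv ℝ (H k) y) ∅ Set.countable_empty
      (fun k => (hs k).continuous.continuousOn)
      (fun x _ k => ((hs k).differentiable (by simp) x).hasFDerivAt)
      ((continuous_finsetSum _ fun k _ => hcd k).continuousOn.integrableOn_compact isCompact_Icc)
    refine this.trans ?_
    refine Finset.sum_eq_zero fun i _ => ?_
    rw [sub_eq_zero]
    congr 1
    funext x
    rw [← hp i (Pi.single i 1) (i.insertNth ((0 : Fin (n+1) → ℝ) i) x)]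
    congr 1
    funext j
    refine Fin.succAboveCases i ?_ (fun j => ?_) j
    · simp
    · simp [Fin.succAbove_ne]

lemma pd_mul {N : ℕ} {f g : (Fin N → ℝ) → ℂ} (hf : ContDiff ℝ (⊤ : ℕ∞) f)
    (hg : ContDiff ℝ (⊤ : ℕ∞) g) (k : Fin N) (y : Fin N → ℝ) :
    pd (fun y => f y * g y) k y = pd f k y * g y + f y * pd g k y := by
  unfold pd
  rw [fderiv_fun_mul (hf.differentiable (by simp) y) (hg.differentiable (by simp) y)]
  simp
  ring

lemma pd_sub {N : ℕ} {f g : (Fin N → ℝ) → ℂ} (hf : ContDiff ℝ (⊤ : ℕ∞) f)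
    (hg : ContDiff ℝ (⊤ : ℕ∞) g) (k : Fin N) (y : Fin N → ℝ) :
    pd (fun y => f y - g y) k y = pd f k y - pd g k y := by
  unfold pd
  rw [fderiv_fun_sub (hf.differentiable (by simp) y) (hg.differentiable (by simp) y)]
  simp

lemma contDiff_conj {N : ℕ} {f : (Fin N → ℝ) → ℂ} (hf : ContDiff ℝ (⊤ : ℕ∞) f) :
    ContDiff ℝ (⊤ : ℕ∞) (fun y => conj (f y)) :=
  Complex.conjCLE.contDiff.comp hf

lemma pd_conj {N : ℕ} {f : (Fin N → ℝ) → ℂ} (hf : ContDiff ℝ (⊤ : ℕ∞) f)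
    (k : Fin N) (y : Fin N → ℝ) :
    pd (fun y => conj (f y)) k y = conj (pd f k y) := by
  have h := ((hf.differentiable (by simp) y).hasFDerivAt)
  have h2 := (Complex.conjCLE.toContinuousLinearMap.hasFDerivAt (x := f y)).comp y h
  have h3 : fderiv ℝ (fun y => conj (f y)) y = _ := h2.fderiv
  unfold pd
  rw [h3]
  rfl

lemma contDiff_ofReal {N : ℕ} {f : (Fin N → ℝ) → ℝ} (hf : ContDiff ℝ (⊤ : ℕ∞) f) :
    ContDiff ℝ (⊤ : ℕ∞) (fun y => (f y : ℂ)) :=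
  Complex.ofRealCLM.contDiff.comp hf

lemma contDiff_gp {N : ℕ} (θ : Fin N → ℝ) {f : (Fin N → ℝ) → ℂ} (hf : ContDiff ℝ (⊤ : ℕ∞) f)
    (k : Fin N) : ContDiff ℝ (⊤ : ℕ∞) (gp θ f k) := by
  have h1 : ContDiff ℝ (⊤ : ℕ∞) (pd f k) :=
    (hf.fderiv_right (by simp)).clm_apply contDiff_const
  exact h1.add (contDiff_const.mul hf)

/-- the flux `A(∇+2iπθ)χ`. -/
noncomputable def flux {N : ℕ} (A : (Fin N → ℝ) → Fin N → Fin N → ℝ)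
    (θ : Fin N → ℝ) (χ : (Fin N → ℝ) → ℂ) (k : Fin N) (y : Fin N → ℝ) : ℂ :=
  ∑ l : Fin N, (A y k l : ℂ) * gp θ χ l y

/-- the vector field `2iπ A eₘ χ`. -/
noncomputable def gflux {N : ℕ} (A : (Fin N → ℝ) → Fin N → Fin N → ℝ)
    (χ : (Fin N → ℝ) → ℂ) (m : Fin N) (k : Fin N) (y : Fin N → ℝ) : ℂ :=
  2 * (π : ℂ) * Complex.I * (A y k m : ℂ) * χ y

lemma gm_eq {N : ℕ} (θ : Fin N → ℝ) (ψ : (Fin N → ℝ) → ℂ) (j : Fin N) (y : Fin N → ℝ) :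
    gm θ ψ j y = conj (gp θ ψ j y) := by
  have h2 : conj (2 : ℂ) = 2 := Complex.conj_ofNat 2
  simp [gm, gp, sub_eq_add_neg, h2]

section
variable {N : ℕ} {A : (Fin N → ℝ) → Fin N → Fin N → ℝ}

lemma contDiff_flux (hA : ∀ k l, ContDiff ℝ (⊤ : ℕ∞) (fun y => A y k l)) (θ : Fin N → ℝ)
    {χ : (Fin N → ℝ) → ℂ} (hχ : ContDiff ℝ (⊤ : ℕ∞) χ) (k : Fin N) :
    ContDiff ℝ (⊤ : ℕ∞) (flux A θ χ k) :=
  ContDiff.sum fun l _ => (contDiff_ofReal (hA k l)).mul (contDiff_gp θ hχ l)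

lemma contDiff_gflux (hA : ∀ k l, ContDiff ℝ (⊤ : ℕ∞) (fun y => A y k l))
    {χ : (Fin N → ℝ) → ℂ} (hχ : ContDiff ℝ (⊤ : ℕ∞) χ) (m k : Fin N) :
    ContDiff ℝ (⊤ : ℕ∞) (gflux A χ m k) :=
  (contDiff_const.mul (contDiff_ofReal (hA k m))).mul hχ

lemma periodic_flux (hA : ∀ k l, ZNPeriodic (fun y => A y k l)) (θ : Fin N → ℝ)
    {χ : (Fin N → ℝ) → ℂ} (hχ : ZNPeriodic χ) (k : Fin N) : ZNPeriodic (flux A θ χ k) := by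
  intro q y
  have h1 := fun l => hA k l q y
  have h2 := fun l => periodic_pd hχ l q y
  have h3 := hχ q y
  simp only at h1
  simp only [flux, gp, h1, h2, h3]

lemma periodic_gflux (hA : ∀ k l, ZNPeriodic (fun y => A y k l))
    {χ : (Fin N → ℝ) → ℂ} (hχ : ZNPeriodic χ) (m k : Fin N) : ZNPeriodic (gflux A χ m k) := by
  intro q y
  have h1 := hA k m q y
  have h3 := hχ q y
  simp only at h1
  simp only [gflux, h1, h3]

/-- pointwise: `𝔸χ·conj ψ` in terms of the flux. -/
lemma blochOp_mul_conj (hA : ∀ k l, ContDiff ℝ (⊤ : ℕ∞) (fun y => A y k l))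
    (c : (Fin N → ℝ) → ℝ) (lam : ℝ) (θ : Fin N → ℝ)
    {χ ψ : (Fin N → ℝ) → ℂ} (hχ : ContDiff ℝ (⊤ : ℕ∞) χ) (hψ : ContDiff ℝ (⊤ : ℕ∞) ψ)
    (y : Fin N → ℝ) :
    blochOp A c lam θ χ y * conj (ψ y) =
      - (∑ k, pd (fun y => flux A θ χ k y * conj (ψ y)) k y)
      + (∑ k, flux A θ χ k y * gm θ ψ k y) + ((c y : ℂ) - lam) * (χ y * conj (ψ y)) := by
  have h : ∀ k, pd (fun y => flux A θ χ k y * conj (ψ y)) k y = _ := fun k =>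
    (pd_mul (contDiff_flux hA θ hχ k) (contDiff_conj hψ) k y).trans
      (by rw [pd_conj hψ])
  have hb : blochOp A c lam θ χ y = - (∑ k, pd (flux A θ χ k) k y)
      - (∑ k, 2 * (π : ℂ) * Complex.I * (θ k : ℂ) * flux A θ χ k y)
      + ((c y : ℂ) - (lam : ℂ)) * χ y := rfl
  simp only [h, hb, gm]
  rw [add_mul, sub_mul, neg_mul, Finset.sum_mul, Finset.sum_mul, ← Finset.sum_neg_distrib,
    ← Finset.sum_neg_distrib, ← Finset.sum_sub_distrib, ← Finset.sum_add_distrib, ← mul_assoc]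
  congr 1
  refine Finset.sum_congr rfl fun k _ => ?_
  ring

lemma dcell_mul_conj (hA : ∀ k l, ContDiff ℝ (⊤ : ℕ∞) (fun y => A y k l)) (θ : Fin N → ℝ)
    {χ ψ : (Fin N → ℝ) → ℂ} (hχ : ContDiff ℝ (⊤ : ℕ∞) χ) (hψ : ContDiff ℝ (⊤ : ℕ∞) ψ)
    (m : Fin N) (y : Fin N → ℝ) :
    dcellθ A θ χ m y * conj (ψ y) =
      (2 * (π : ℂ) * Complex.I * flux A θ χ m y * conj (ψ y)
        - ∑ j, gflux A χ m j y * gm θ ψ j y)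
      + ∑ k, pd (fun y => gflux A χ m k y * conj (ψ y)) k y := by
  have h : ∀ k, pd (fun y => gflux A χ m k y * conj (ψ y)) k y = _ := fun k =>
    (pd_mul (contDiff_gflux hA hχ m k) (contDiff_conj hψ) k y).trans
      (by rw [pd_conj hψ])
  have hb : dcellθ A θ χ m y = 2 * (π : ℂ) * Complex.I * flux A θ χ m y
      + (∑ k, pd (gflux A χ m k) k y)
      + (∑ k, 2 * (π : ℂ) * Complex.I * (θ k : ℂ) * gflux A χ m k y) := rfl
  simp only [h, hb, gm]
  rw [add_mul, add_mul, Finset.sum_mul, Finset.sum_mul, add_assoc, sub_add, sub_eq_add_neg,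
    ← Finset.sum_sub_distrib, ← Finset.sum_add_distrib, ← Finset.sum_neg_distrib]
  congr 1
  refine Finset.sum_congr rfl fun k _ => ?_
  ring

lemma flux_symm (hs : ∀ y k l, A y k l = A y l k) (θ : Fin N → ℝ)
    (χ ψ : (Fin N → ℝ) → ℂ) (y : Fin N → ℝ) :
    conj (∑ k, flux A θ ψ k y * gm θ χ k y) = ∑ k, flux A θ χ k y * gm θ ψ k y := by
  simp only [gm_eq, flux, map_sum, map_mul, Complex.conj_conj, Complex.conj_ofReal,
    Finset.sum_mul]
  rw [Finset.sum_comm]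
  refine Finset.sum_congr rfl fun k _ => Finset.sum_congr rfl fun l _ => ?_
  rw [hs y l k]
  ring

end

theorem theta_hessian_identity
    (N : ℕ) (hN : 1 ≤ N) (θ : Fin N → ℝ)
    (A : (Fin N → ℝ) → Fin N → Fin N → ℝ)
    (hA_reg : ∀ k l, ContDiff ℝ (⊤ : ℕ∞) (fun y => A y k l))
    (hA_per : ∀ k l, ZNPeriodic (fun y => A y k l))
    (hA_symm : ∀ y k l, A y k l = A y l k)
    (c : (Fin N → ℝ) → ℝ) (hc_reg : ContDiff ℝ (⊤ : ℕ∞) c) (hc_per : ZNPeriodic c)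
    (lam : ℝ)
    (ψ : (Fin N → ℝ) → ℂ)
    (hψ_reg : ContDiff ℝ (⊤ : ℕ∞) ψ) (hψ_per : ZNPeriodic ψ)
    (hψ_norm : ∫ y in unitCell N, ‖ψ y‖ ^ 2 = 1)
    (hψ_eq : ∀ y, blochOp A c lam θ ψ y = 0)
    (k l : Fin N)
    (φk φl : (Fin N → ℝ) → ℂ)
    (hφk_reg : ContDiff ℝ (⊤ : ℕ∞) φk) (hφk_per : ZNPeriodic φk)
    (hφl_reg : ContDiff ℝ (⊤ : ℕ∞) φl) (hφl_per : ZNPeriodic φl)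
    (hφk_eq : ∀ y, blochOp A c lam θ φk y = dcellθ A θ ψ k y)
    (hφl_eq : ∀ y, blochOp A c lam θ φl y = dcellθ A θ ψ l y)
    (ξ : (Fin N → ℝ) → ℂ) (Λ : ℂ)
    (hξ_reg : ContDiff ℝ (⊤ : ℕ∞) ξ) (hξ_per : ZNPeriodic ξ)
    (hξ_eq : ∀ y, blochOp A c lam θ ξ y =
      dcellθ A θ φl k y + dcellθ A θ φk l y
        - ((4 * π ^ 2 * (A y k l + A y l k) : ℝ) : ℂ) * ψ y + Λ * ψ y) :
    (∫ y in unitCell N,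
        (2 * (π : ℂ) * Complex.I * (∑ j : Fin N, (A y k j : ℂ) * gp θ φl j y) * conj (ψ y)
          - ∑ j : Fin N, (2 * (π : ℂ) * Complex.I * (A y j k : ℂ) * φl y) * gm θ ψ j y))
    + (∫ y in unitCell N,
        (2 * (π : ℂ) * Complex.I * (∑ j : Fin N, (A y l j : ℂ) * gp θ φk j y) * conj (ψ y)
          - ∑ j : Fin N, (2 * (π : ℂ) * Complex.I * (A y j l : ℂ) * φk y) * gm θ ψ j y))
    - (∫ y in unitCell N,
        ((4 * π ^ 2 * (A y k l + A y l k) : ℝ) : ℂ) * ((‖ψ y‖ ^ 2 : ℝ) : ℂ))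
    + Λ = 0 := by
  classical
  set B1 : (Fin N → ℝ) → ℂ := fun y =>
    2 * (π : ℂ) * Complex.I * flux A θ φl k y * conj (ψ y)
        - ∑ j, gflux A φl k j y * gm θ ψ j y with hB1
  set B2 : (Fin N → ℝ) → ℂ := fun y =>
    2 * (π : ℂ) * Complex.I * flux A θ φk l y * conj (ψ y)
        - ∑ j, gflux A φk l j y * gm θ ψ j y with hB2
  set B3 : (Fin N → ℝ) → ℂ := fun y =>
    ((4 * π ^ 2 * (A y k l + A y l k) : ℝ) : ℂ) * ((‖ψ y‖ ^ 2 : ℝ) : ℂ) with hB3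
  set B4 : (Fin N → ℝ) → ℂ := fun y => ((‖ψ y‖ ^ 2 : ℝ) : ℂ) with hB4
  change (∫ y in unitCell N, B1 y) + (∫ y in unitCell N, B2 y) - (∫ y in unitCell N, B3 y) + Λ = 0
  have hcψ := contDiff_conj hψ_reg
  set H1 : Fin N → (Fin N → ℝ) → ℂ := fun j y => conj (flux A θ ψ j y * conj (ξ y)) with hH1
  set H2 : Fin N → (Fin N → ℝ) → ℂ := fun j y => flux A θ ξ j y * conj (ψ y) with hH2
  set H3 : Fin N → (Fin N → ℝ) → ℂ := fun j y => gflux A φl k j y * conj (ψ y) with hH3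
  set H4 : Fin N → (Fin N → ℝ) → ℂ := fun j y => gflux A φk l j y * conj (ψ y) with hH4
  have s1' : ∀ j, ContDiff ℝ (⊤ : ℕ∞) (fun y => flux A θ ψ j y * conj (ξ y)) := fun j =>
    (contDiff_flux hA_reg θ hψ_reg j).mul (contDiff_conj hξ_reg)
  have s1 : ∀ j, ContDiff ℝ (⊤ : ℕ∞) (H1 j) := fun j => contDiff_conj (s1' j)
  have s2 : ∀ j, ContDiff ℝ (⊤ : ℕ∞) (H2 j) := fun j =>
    (contDiff_flux hA_reg θ hξ_reg j).mul hcψ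
  have s3 : ∀ j, ContDiff ℝ (⊤ : ℕ∞) (H3 j) := fun j =>
    (contDiff_gflux hA_reg hφl_reg k j).mul hcψ
  have s4 : ∀ j, ContDiff ℝ (⊤ : ℕ∞) (H4 j) := fun j =>
    (contDiff_gflux hA_reg hφk_reg l j).mul hcψ
  have hz := integral_div_zero (fun j y => H1 j y - H2 j y - H3 j y - H4 j y)
    (fun j => (((s1 j).sub (s2 j)).sub (s3 j)).sub (s4 j))
    (by
      intro j q y
      have h1 := periodic_flux hA_per θ hψ_per j q y
      have h2 := periodic_flux hA_per θ hξ_per j q y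
      have h3 := periodic_gflux hA_per hφl_per k j q y
      have h4 := periodic_gflux hA_per hφk_per l j q y
      have h5 := hψ_per q y
      have h6 := hξ_per q y
      simp only [hH1, hH2, hH3, hH4, h1, h2, h3, h4, h5, h6])
  have hpt : ∀ y, ∑ j, pd (fun y => H1 j y - H2 j y - H3 j y - H4 j y) j y
      = B1 y + B2 y - B3 y + Λ * B4 y := by
    intro y
    have e : ∀ j, pd (fun y => H1 j y - H2 j y - H3 j y - H4 j y) j y
        = pd (H1 j) j y - pd (H2 j) j y - pd (H3 j) j y - pd (H4 j) j y := fun j => by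
      rw [pd_sub (((s1 j).sub (s2 j)).sub (s3 j)) (s4 j), pd_sub ((s1 j).sub (s2 j)) (s3 j),
        pd_sub (s1 j) (s2 j)]
    simp only [e, Finset.sum_sub_distrib]
    have a1 := congrArg conj (blochOp_mul_conj hA_reg c lam θ hψ_reg hξ_reg y)
    rw [hψ_eq y] at a1
    simp only [map_add, map_neg, flux_symm hA_symm] at a1
    have a1' : conj (∑ j, pd (fun y => flux A θ ψ j y * conj (ξ y)) j y)
        = ∑ j, pd (H1 j) j y := by
      rw [map_sum]
      exact Finset.sum_congr rfl fun j _ => (pd_conj (s1' j) j y).symm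
    rw [a1'] at a1
    simp only [zero_mul, map_zero, map_mul, map_sub, Complex.conj_ofReal,
      Complex.conj_conj] at a1
    have a2 := blochOp_mul_conj hA_reg c lam θ hξ_reg hψ_reg y
    rw [hξ_eq y] at a2
    have a3 := dcell_mul_conj hA_reg θ hφl_reg hψ_reg k y
    have a4 := dcell_mul_conj hA_reg θ hφk_reg hψ_reg l y
    have a5 : B4 y = ψ y * conj (ψ y) := by
      rw [Complex.mul_conj, hB4, Complex.normSq_eq_norm_sq]
    have a6 : B3 y = ((4 * π ^ 2 * (A y k l + A y l k) : ℝ) : ℂ) * B4 y := rfl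
    change _ = B1 y + ∑ j, pd (H3 j) j y at a3
    change _ = B2 y + ∑ j, pd (H4 j) j y at a4
    change _ = - (∑ j, pd (H2 j) j y) + _ + _ at a2
    rw [a6, a5]
    linear_combination a1 - a2 + a3 + a4
  simp only [hpt] at hz
  have hcpt : IsCompact (unitCell N) := isCompact_univ_pi fun _ => isCompact_Icc
  have hint : ∀ f : (Fin N → ℝ) → ℂ, Continuous f →
      Integrable f (volume.restrict (unitCell N)) := fun f hf =>
    hf.continuousOn.integrableOn_compact hcpt
  have hgm : ∀ j, Continuous (gm θ ψ j) := fun j => by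
    have : gm θ ψ j = fun y => conj (gp θ ψ j y) := funext fun y => gm_eq θ ψ j y
    rw [this]
    exact (contDiff_conj (contDiff_gp θ hψ_reg j)).continuous
  have c1 : Continuous B1 :=
    ((continuous_const.mul (contDiff_flux hA_reg θ hφl_reg k).continuous).mul hcψ.continuous).sub
      (continuous_finsetSum _ fun j _ => (contDiff_gflux hA_reg hφl_reg k j).continuous.mul (hgm j))
  have c2 : Continuous B2 :=
    ((continuous_const.mul (contDiff_flux hA_reg θ hφk_reg l).continuous).mul hcψ.continuous).sub
      (continuous_finsetSum _ fun j _ => (contDiff_gflux hA_reg hφk_reg l j).continuous.mul (hgm j))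
  have c4 : Continuous B4 := Complex.continuous_ofReal.comp (hψ_reg.continuous.norm.pow 2)
  have c3 : Continuous B3 := (Complex.continuous_ofReal.comp (continuous_const.mul
    ((hA_reg k l).continuous.add (hA_reg l k).continuous))).mul c4
  have i4 : ∫ y in unitCell N, B4 y = 1 := by
    have h : ∫ y in unitCell N, B4 y = ((∫ y in unitCell N, ‖ψ y‖ ^ 2 : ℝ) : ℂ) := integral_ofReal
    rw [h, hψ_norm]
    simp
  have j1 : ∫ y in unitCell N, (B1 y + B2 y - B3 y + Λ * B4 y)
      = (∫ y in unitCell N, (B1 y + B2 y - B3 y)) + ∫ y in unitCell N, Λ * B4 y :=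
    integral_add (((hint _ c1).add (hint _ c2)).sub (hint _ c3)) ((hint _ c4).const_mul Λ)
  have j2 : ∫ y in unitCell N, (B1 y + B2 y - B3 y)
      = (∫ y in unitCell N, (B1 y + B2 y)) - ∫ y in unitCell N, B3 y :=
    integral_sub ((hint _ c1).add (hint _ c2)) (hint _ c3)
  rw [j1, j2, integral_add (hint _ c1) (hint _ c2), integral_const_mul, i4, mul_one] at hz
  exact hz
end

section
/- Let ψ : ℝ^N → ℂ be smooth, ℤ^N-periodic, with 𝔸ψ = 0 on ℝ^N (i.e. ψ solves the Bloch spectral cell equation with eigenvalue λ). Then for every ε > 0 and every smooth compactly supported function φ : ℝ^N → ℂ, ∫_{ℝ^N} [ A(z/√ε)·(∇ψ(z/√ε) + 2iπθ⁰ψ(z/√ε)) · (√ε·∇conj(φ)(z) − 2iπθ⁰·conj(φ)(z)) + (c(z/√ε) − λ)·ψ(z/√ε)·conj(φ)(z) ] dz = 0. -/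
open MeasureTheory Real ComplexConjugate

lemma smooth_flux {N : ℕ} (θ : Fin N → ℝ) (A : (Fin N → ℝ) → Fin N → Fin N → ℝ)
    (hA_reg : ∀ k l, ContDiff ℝ (⊤ : ℕ∞) (fun y => A y k l))
    (ψ : (Fin N → ℝ) → ℂ) (hψ_reg : ContDiff ℝ (⊤ : ℕ∞) ψ) (k : Fin N) :
    ContDiff ℝ (⊤ : ℕ∞) (fun y => ∑ l : Fin N, (A y k l : ℂ) * gp θ ψ l y) := by
  apply ContDiff.sum
  intro l _
  have h1 : ContDiff ℝ (⊤ : ℕ∞) (fun y => (A y k l : ℂ)) :=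
    Complex.ofRealCLM.contDiff.comp (hA_reg k l)
  have h2 : ContDiff ℝ (⊤ : ℕ∞) (fun y => fderiv ℝ ψ y (Pi.single l 1)) :=
    (hψ_reg.fderiv_right (m := (⊤ : ℕ∞)) (by simp)).clm_apply contDiff_const
  unfold gp pd
  exact h1.mul (h2.add (contDiff_const.mul hψ_reg))

lemma ibp_pair {N : ℕ} (G h : (Fin N → ℝ) → ℂ) (hG : ContDiff ℝ (⊤ : ℕ∞) G)
    (hh : ContDiff ℝ (⊤ : ℕ∞) h) (hc : HasCompactSupport h) (v : Fin N → ℝ) :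
    Integrable (fun z => G z * fderiv ℝ h z v + fderiv ℝ G z v * h z) ∧
    ∫ z, (G z * fderiv ℝ h z v + fderiv ℝ G z v * h z) = 0 := by
  have cG' : Continuous (fun z => fderiv ℝ G z v) :=
    (hG.continuous_fderiv (by simp)).clm_apply continuous_const
  have ch' : Continuous (fun z => fderiv ℝ h z v) :=
    (hh.continuous_fderiv (by simp)).clm_apply continuous_const
  have i1 : Integrable (fun z => fderiv ℝ G z v * h z) :=
    (cG'.mul hh.continuous).integrable_of_hasCompactSupport hc.mul_left
  have i2 : Integrable (fun z => G z * fderiv ℝ h z v) :=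
    (hG.continuous.mul ch').integrable_of_hasCompactSupport (hc.fderiv_apply ℝ v).mul_left
  have i3 : Integrable (fun z => G z * h z) :=
    (hG.continuous.mul hh.continuous).integrable_of_hasCompactSupport hc.mul_left
  refine ⟨i2.add i1, ?_⟩
  rw [integral_add i2 i1, integral_mul_fderiv_eq_neg_fderiv_mul_of_integrable i1 i2 i3
    (fun x _ => (hG.differentiable (by simp)).differentiableAt)
    (fun x _ => (hh.differentiable (by simp)).differentiableAt)]
  simp

theorem rescaled_variational_formulation
    (N : ℕ) (hN : 1 ≤ N) (θ : Fin N → ℝ)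
    (A : (Fin N → ℝ) → Fin N → Fin N → ℝ)
    (hA_reg : ∀ k l, ContDiff ℝ (⊤ : ℕ∞) (fun y => A y k l))
    (hA_per : ∀ k l, ZNPeriodic (fun y => A y k l))
    (hA_symm : ∀ y k l, A y k l = A y l k)
    (c : (Fin N → ℝ) → ℝ) (hc_reg : ContDiff ℝ (⊤ : ℕ∞) c) (hc_per : ZNPeriodic c)
    (lam : ℝ)
    (ψ : (Fin N → ℝ) → ℂ)
    (hψ_reg : ContDiff ℝ (⊤ : ℕ∞) ψ) (hψ_per : ZNPeriodic ψ)
    (hψ_eq : ∀ y, blochOp A c lam θ ψ y = 0) :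
    ∀ ε : ℝ, 0 < ε →
    ∀ φ : (Fin N → ℝ) → ℂ, ContDiff ℝ (⊤ : ℕ∞) φ → HasCompactSupport φ →
    ∫ z : Fin N → ℝ,
      ((∑ k : Fin N,
          (∑ l : Fin N, (A ((Real.sqrt ε)⁻¹ • z) k l : ℂ) * gp θ ψ l ((Real.sqrt ε)⁻¹ • z))
            * ((Real.sqrt ε : ℂ) * conj (pd φ k z)
                - 2 * (π : ℂ) * Complex.I * (θ k : ℂ) * conj (φ z)))
        + ((c ((Real.sqrt ε)⁻¹ • z) : ℂ) - (lam : ℂ)) * ψ ((Real.sqrt ε)⁻¹ • z) * conj (φ z))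
      = 0 := by
  intro ε hε φ hφ hφc
  set s := Real.sqrt ε with hs
  have hs0 : (s : ℂ) ≠ 0 := by
    have : 0 < s := Real.sqrt_pos.mpr hε
    exact_mod_cast this.ne'
  obtain ⟨F, hFe⟩ : ∃ F : Fin N → (Fin N → ℝ) → ℂ,
      F = fun k y => ∑ l : Fin N, (A y k l : ℂ) * gp θ ψ l y := ⟨_, rfl⟩
  have hF : ∀ k, ContDiff ℝ (⊤ : ℕ∞) (F k) := by
    rw [hFe]
    exact smooth_flux θ A hA_reg ψ hψ_reg
  have hFk : ∀ k y, ∑ l : Fin N, (A y k l : ℂ) * gp θ ψ l y = F k y := by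
    rw [hFe]
    exact fun k y => rfl
  simp only [blochOp, hFk] at hψ_eq
  simp only [hFk]
  have hh : ContDiff ℝ (⊤ : ℕ∞) (fun z => conj (φ z)) :=
    Complex.conjCLE.contDiff.comp hφ
  have hhc : HasCompactSupport (fun z => conj (φ z)) :=
    hφc.comp_left (g := fun w : ℂ => conj w) (by simp)
  have hG : ∀ k, ContDiff ℝ (⊤ : ℕ∞)
      (fun z : Fin N → ℝ => F k (s⁻¹ • z)) :=
    fun k => (hF k).comp (contDiff_const_smul s⁻¹)
  have key := fun k => ibp_pair _ _ (hG k) hh hhc (Pi.single k 1)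
  have dh : ∀ k z, fderiv ℝ (fun z => conj (φ z)) z (Pi.single k 1) = conj (pd φ k z) := by
    intro k z
    have h1 : HasFDerivAt φ (fderiv ℝ φ z) z :=
      ((hφ.differentiable (by simp)) z).hasFDerivAt
    have h2 := (Complex.conjCLE.toContinuousLinearMap.hasFDerivAt (x := φ z)).comp z h1
    have h3 := h2.fderiv
    have h4 := congrArg (fun L => L (Pi.single k (1 : ℝ))) h3
    exact h4
  have dG : ∀ k z, fderiv ℝ
      (fun z : Fin N → ℝ => F k (s⁻¹ • z)) z
        (Pi.single k 1)
      = (s : ℂ)⁻¹ * fderiv ℝ (F k) (s⁻¹ • z)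
        (Pi.single k 1) := by
    intro k z
    have h := congrArg (fun L => L (Pi.single k (1 : ℝ)))
      (fderiv_comp_smul (𝕜 := ℝ) (f := F k) (x := z) s⁻¹)
    simpa using h
  simp only [dh, dG] at key
  have tot := integral_finsetSum Finset.univ
    (fun k _ => ((key k).1.const_mul (s : ℂ)))
  simp only [integral_const_mul, fun k => (key k).2, mul_zero, Finset.sum_const_zero] at tot
  refine Eq.trans ?_ tot
  congr 1
  ext z
  have e := hψ_eq (s⁻¹ • z)
  have e2 : ((c (s⁻¹ • z) : ℂ) - (lam : ℂ)) * ψ (s⁻¹ • z) =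
      (∑ k : Fin N, fderiv ℝ
        (F k) (s⁻¹ • z) (Pi.single k 1))
      + (∑ k : Fin N, 2 * (π : ℂ) * Complex.I * (θ k : ℂ)
        * F k (s⁻¹ • z)) := by
    linear_combination e
  rw [e2, ← Finset.sum_add_distrib, Finset.sum_mul, ← Finset.sum_add_distrib]
  refine Finset.sum_congr rfl fun k _ => ?_
  field_simp
  ring
end
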